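/- arXiv:1309.6940 — 3 statements merged into one kernel-verified Lean document; each statement's English description precedes it below -/
import Mathlib

section
/- Suppose every (S_n, ρ_n) is separable, every φ_n (n ≥ 1) is continuous, μ_n is a Borel probability measure on S_n for each n ≥ 0, and the pushforwards μ_n ∘ φ_n⁻¹ converge weakly to μ_0. Define Borel probability measures μ̃_n on (T, δ) by μ̃_n(B) = μ_n(B ∩ S_n) for Borel sets B ⊆ T (equivalently, μ̃_n is the pushforward of μ_n under the inclusion S_n ↪ T). Then μ̃_n converges weakly to μ̃_0 on (T, δ). -/
open Filter MeasureTheory Topology TopologicalSpace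

/-- Within-fiber distance on the disjoint union `T = Σ n, S n`:
equals `ρ_{s(x)}(x, y)` when `s(x) = s(y)`, and `0` otherwise (unused case). -/
noncomputable def fiberDist {S : ℕ → Type*} [∀ n, MetricSpace (S n)]
    (x y : Σ n, S n) : ℝ :=
  if h : x.1 = y.1 then dist (h ▸ x.2) y.2 else 0

/-- The metric `δ` on the disjoint union `T = Σ n, S n`:
`δ(x,y) = ρ₀(φ(x), φ(y)) + (min (ε_{s x}) (ρ_{s x}(x,y))` if `s x = s y`,
`else max (ε_{s x}) (ε_{s y}))`. -/
noncomputable def tdelta {S : ℕ → Type*} [∀ n, MetricSpace (S n)]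
    (φ : ∀ n, S n → S 0) (ε : ℕ → ℝ) (x y : Σ n, S n) : ℝ :=
  dist (φ x.1 x.2) (φ y.1 y.2) +
    (if x.1 = y.1 then min (ε x.1) (fiberDist x y) else max (ε x.1) (ε y.1))

section

variable {S : ℕ → Type*} [∀ n, MetricSpace (S n)]

lemma tdelta_zero_left {φ : ∀ n, S n → S 0} (hφ0 : φ 0 = id) {ε : ℕ → ℝ} (hε0 : ε 0 = 0)
    (hε : ∀ n, 0 ≤ ε n) (x : S 0) (y : Σ n, S n) :
    tdelta φ ε ⟨0, x⟩ y = dist x (φ y.1 y.2) + ε y.1 := by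
  obtain ⟨n, y⟩ := y
  rcases eq_or_ne 0 n with rfl | h
  · simp [tdelta, fiberDist, hφ0, hε0]
  · simp [tdelta, hφ0, hε0, h, hε n]

lemma tdelta_mk_mk_le (φ : ∀ n, S n → S 0) (ε : ℕ → ℝ) {n : ℕ} (x y : S n) :
    tdelta φ ε ⟨n, x⟩ ⟨n, y⟩ ≤ dist (φ n x) (φ n y) + dist x y := by
  simp [tdelta, fiberDist]

lemma continuous_fiber_of_tdelta {φ : ∀ n, S n → S 0} {ε : ℕ → ℝ} {f : (Σ n, S n) → ℝ}
    (hf : ∀ x : Σ n, S n, ∀ η : ℝ, 0 < η → ∃ r : ℝ, 0 < r ∧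
      ∀ y : Σ n, S n, tdelta φ ε x y < r → |f y - f x| < η)
    {n : ℕ} (hφ : Continuous (φ n)) : Continuous fun x : S n => f ⟨n, x⟩ := by
  refine continuous_iff_continuousAt.2 fun x => Metric.tendsto_nhds.2 fun η hη => ?_
  obtain ⟨r, hr, h⟩ := hf ⟨n, x⟩ η hη
  have ht : Tendsto (fun y => dist (φ n x) (φ n y) + dist x y) (𝓝 x) (𝓝 0) := by
    have hc : Continuous fun y => dist (φ n x) (φ n y) + dist x y := by fun_prop
    simpa using hc.tendsto x
  filter_upwards [ht.eventually_lt_const hr] with y hy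
  exact h ⟨n, y⟩ ((tdelta_mk_mk_le φ ε x y).trans_lt hy)

/-- The infimal convolution of `f` with `k` times the distance `δ` to points of `S 0`. -/
noncomputable def lowerEnvelope (φ : ∀ n, S n → S 0) (ε : ℕ → ℝ) (f : (Σ n, S n) → ℝ) (k : ℕ)
    (x : S 0) : ℝ :=
  ⨅ y : Σ n, S n, (f y + k * (dist x (φ y.1 y.2) + ε y.1))

variable {φ : ∀ n, S n → S 0} {ε : ℕ → ℝ} {f : (Σ n, S n) → ℝ} {C : ℝ}

lemma neg_le_lowerEnvelope_term (hε : ∀ n, 0 ≤ ε n) (hC : ∀ x, |f x| ≤ C) (k : ℕ) (x : S 0)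
    (y : Σ n, S n) : -C ≤ f y + k * (dist x (φ y.1 y.2) + ε y.1) := by
  have h1 : 0 ≤ (k : ℝ) * (dist x (φ y.1 y.2) + ε y.1) :=
    mul_nonneg k.cast_nonneg (add_nonneg dist_nonneg (hε _))
  linarith [(abs_le.1 (hC y)).1]

lemma lowerEnvelope_le (hε : ∀ n, 0 ≤ ε n) (hC : ∀ x, |f x| ≤ C) (k : ℕ) (x : S 0)
    (y : Σ n, S n) : lowerEnvelope φ ε f k x ≤ f y + k * (dist x (φ y.1 y.2) + ε y.1) :=
  ciInf_le ⟨-C, Set.forall_mem_range.2 (neg_le_lowerEnvelope_term hε hC k x)⟩ y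

lemma lowerEnvelope_le_self (hφ0 : φ 0 = id) (hε0 : ε 0 = 0) (hε : ∀ n, 0 ≤ ε n)
    (hC : ∀ x, |f x| ≤ C) (k : ℕ) (x : S 0) : lowerEnvelope φ ε f k x ≤ f ⟨0, x⟩ := by
  simpa [hφ0, hε0] using lowerEnvelope_le (φ := φ) hε hC k x ⟨0, x⟩

lemma abs_lowerEnvelope_le (hφ0 : φ 0 = id) (hε0 : ε 0 = 0) (hε : ∀ n, 0 ≤ ε n)
    (hC : ∀ x, |f x| ≤ C) (k : ℕ) (x : S 0) : |lowerEnvelope φ ε f k x| ≤ C := by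
  have : Nonempty (Σ n, S n) := ⟨⟨0, x⟩⟩
  exact abs_le.2 ⟨le_ciInf (neg_le_lowerEnvelope_term hε hC k x),
    (lowerEnvelope_le_self hφ0 hε0 hε hC k x).trans (abs_le.1 (hC _)).2⟩

lemma lipschitzWith_lowerEnvelope (hε : ∀ n, 0 ≤ ε n) (hC : ∀ x, |f x| ≤ C) (k : ℕ) :
    LipschitzWith k (lowerEnvelope φ ε f k) := by
  refine LipschitzWith.of_le_add_mul _ fun x x' => ?_
  have : Nonempty (Σ n, S n) := ⟨⟨0, x⟩⟩
  rw [← sub_le_iff_le_add]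
  refine le_ciInf fun y => ?_
  have h1 := lowerEnvelope_le (φ := φ) hε hC k x y
  have h2 : (k : ℝ) * dist x (φ y.1 y.2) ≤ k * (dist x x' + dist x' (φ y.1 y.2)) := by
    gcongr
    exact dist_triangle _ _ _
  simp only [NNReal.coe_natCast]
  linarith

lemma tendsto_lowerEnvelope (hφ0 : φ 0 = id) (hε0 : ε 0 = 0) (hε : ∀ n, 0 ≤ ε n)
    (hf : ∀ x : Σ n, S n, ∀ η : ℝ, 0 < η → ∃ r : ℝ, 0 < r ∧
      ∀ y : Σ n, S n, tdelta φ ε x y < r → |f y - f x| < η)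
    (hC : ∀ x, |f x| ≤ C) (x : S 0) :
    Tendsto (fun k => lowerEnvelope φ ε f k x) atTop (𝓝 (f ⟨0, x⟩)) := by
  have : Nonempty (Σ n, S n) := ⟨⟨0, x⟩⟩
  refine tendsto_order.2 ⟨fun a ha => ?_, fun a ha => Eventually.of_forall fun k =>
    (lowerEnvelope_le_self hφ0 hε0 hε hC k x).trans_lt ha⟩
  obtain ⟨b, hab, hb⟩ := exists_between ha
  obtain ⟨r, hr, h⟩ := hf ⟨0, x⟩ (f ⟨0, x⟩ - b) (sub_pos.2 hb)
  have hk : ∀ᶠ k : ℕ in atTop, 2 * C ≤ k * r :=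
    (tendsto_natCast_atTop_atTop.atTop_mul_const hr).eventually_ge_atTop _
  filter_upwards [hk] with k hk
  refine hab.trans_le (le_ciInf fun y => ?_)
  have hd : 0 ≤ dist x (φ y.1 y.2) + ε y.1 := add_nonneg dist_nonneg (hε _)
  rcases lt_or_ge (dist x (φ y.1 y.2) + ε y.1) r with hy | hy
  · have h1 := (abs_lt.1 (h y ((tdelta_zero_left hφ0 hε0 hε x y).trans_lt hy))).1
    have h2 := mul_nonneg k.cast_nonneg hd (α := ℝ)
    linarith
  · have h1 : (k : ℝ) * r ≤ k * (dist x (φ y.1 y.2) + ε y.1) := by gcongr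
    linarith [(abs_le.1 (hC y)).1, (abs_le.1 (hC ⟨0, x⟩)).2]

lemma eventually_lt_integral_of_tdelta [∀ n, MeasurableSpace (S n)] [∀ n, BorelSpace (S n)]
    (hφ0 : φ 0 = id) (hφc : ∀ n, Continuous (φ n)) (hε0 : ε 0 = 0) (hε : ∀ n, 0 ≤ ε n)
    (hεlim : Tendsto ε atTop (𝓝 0))
    (μ : ∀ n, Measure (S n)) [∀ n, IsProbabilityMeasure (μ n)]
    (hweak : ∀ f : BoundedContinuousFunction (S 0) ℝ,
      Tendsto (fun n => ∫ x, f x ∂((μ n).map (φ n))) atTop (𝓝 (∫ x, f x ∂(μ 0))))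
    (hf : ∀ x : Σ n, S n, ∀ η : ℝ, 0 < η → ∃ r : ℝ, 0 < r ∧
      ∀ y : Σ n, S n, tdelta φ ε x y < r → |f y - f x| < η)
    (hC : ∀ x, |f x| ≤ C) {a : ℝ} (ha : a < ∫ x, f ⟨0, x⟩ ∂(μ 0)) :
    ∀ᶠ n in atTop, a < ∫ x, f ⟨n, x⟩ ∂(μ n) := by
  have hcont (k : ℕ) : Continuous (lowerEnvelope φ ε f k) :=
    (lipschitzWith_lowerEnvelope hε hC k).continuous
  have hlim : Tendsto (fun k => ∫ x, lowerEnvelope φ ε f k x ∂(μ 0)) atTop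
      (𝓝 (∫ x, f ⟨0, x⟩ ∂(μ 0))) :=
    tendsto_integral_of_dominated_convergence (fun _ => C)
      (fun k => (hcont k).measurable.aestronglyMeasurable) (integrable_const _)
      (fun k => Eventually.of_forall (abs_lowerEnvelope_le hφ0 hε0 hε hC k))
      (Eventually.of_forall (tendsto_lowerEnvelope hφ0 hε0 hε hf hC))
  obtain ⟨k, hk⟩ := (hlim.eventually_const_lt ha).exists
  let F : BoundedContinuousFunction (S 0) ℝ := .ofNormedAddCommGroup (lowerEnvelope φ ε f k)
    (hcont k) C (abs_lowerEnvelope_le hφ0 hε0 hε hC k)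
  have hF : Tendsto (fun n => ∫ x, F x ∂((μ n).map (φ n)) - k * ε n) atTop
      (𝓝 (∫ x, F x ∂(μ 0))) := by
    simpa using (hweak F).sub (hεlim.const_mul (k : ℝ))
  filter_upwards [hF.eventually_const_lt hk] with n hn
  refine hn.trans_le ?_
  have hFint : Integrable (fun x => F (φ n x)) (μ n) :=
    Integrable.of_bound ((hcont k).comp (hφc n)).measurable.aestronglyMeasurable C
      (Eventually.of_forall fun x => abs_lowerEnvelope_le hφ0 hε0 hε hC k (φ n x))
  have hfint : Integrable (fun x => f ⟨n, x⟩) (μ n) :=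
    Integrable.of_bound (continuous_fiber_of_tdelta hf (hφc n)).measurable.aestronglyMeasurable C
      (Eventually.of_forall fun x => hC ⟨n, x⟩)
  calc ∫ x, F x ∂((μ n).map (φ n)) - k * ε n
      = ∫ x, (F (φ n x) - k * ε n) ∂(μ n) := by
        rw [integral_map (hφc n).measurable.aemeasurable
          F.continuous.measurable.aestronglyMeasurable,
          integral_sub hFint (integrable_const _)]
        simp
    _ ≤ ∫ x, f ⟨n, x⟩ ∂(μ n) := by
        refine integral_mono (hFint.sub (integrable_const _)) hfint fun x => ?_
        have h := lowerEnvelope_le (φ := φ) hε hC k (φ n x) ⟨n, x⟩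
        simp only [dist_self, zero_add] at h
        exact sub_le_iff_le_add.2 h

end

/-- under the same hypotheses as Statement 9, the measures
`μ̃ n (B) = μ n (B ∩ S n)` on `(T, δ)` converge weakly to `μ̃ 0`: for every bounded
`δ`-continuous `f : T → ℝ`, `∫ f dμ̃ n = ∫ f(⟨n, ·⟩) dμ n → ∫ f(⟨0, ·⟩) dμ 0`. -/
theorem tdelta_weak_convergence
    (S : ℕ → Type*) [∀ n, MetricSpace (S n)]
    [∀ n, TopologicalSpace.SeparableSpace (S n)]
    [∀ n, MeasurableSpace (S n)] [∀ n, BorelSpace (S n)]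
    (φ : ∀ n, S n → S 0) (hφ0 : φ 0 = id)
    (hφc : ∀ n, 1 ≤ n → Continuous (φ n))
    (ε : ℕ → ℝ) (hε0 : ε 0 = 0) (hεpos : ∀ n, 1 ≤ n → 0 < ε n)
    (hεanti : StrictAntiOn ε (Set.Ici 1))
    (hεlim : Tendsto ε atTop (nhds 0))
    (μ : ∀ n, MeasureTheory.Measure (S n)) [∀ n, IsProbabilityMeasure (μ n)]
    (hweak : ∀ f : BoundedContinuousFunction (S 0) ℝ,
      Tendsto (fun n => ∫ x, f x ∂ ((μ n).map (φ n))) atTop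
        (nhds (∫ x, f x ∂ (μ 0)))) :
    ∀ f : (Σ n, S n) → ℝ,
      -- `f` is continuous with respect to the metric `δ`
      (∀ x : Σ n, S n, ∀ η : ℝ, 0 < η → ∃ r : ℝ, 0 < r ∧
          ∀ y : Σ n, S n, tdelta φ ε x y < r → |f y - f x| < η) →
      -- `f` is bounded
      (∃ C : ℝ, ∀ x : Σ n, S n, |f x| ≤ C) →
      Tendsto (fun n => ∫ x, f ⟨n, x⟩ ∂ (μ n)) atTop
        (nhds (∫ x, f ⟨0, x⟩ ∂ (μ 0))) := by
  rintro f hf ⟨C, hC⟩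
  have hε (n : ℕ) : 0 ≤ ε n := by
    rcases n.eq_zero_or_pos with rfl | hn
    exacts [hε0.ge, (hεpos n hn).le]
  have hφ (n : ℕ) : Continuous (φ n) := by
    rcases n.eq_zero_or_pos with rfl | hn
    exacts [hφ0 ▸ continuous_id, hφc n hn]
  refine tendsto_order.2 ⟨fun a ha =>
    eventually_lt_integral_of_tdelta hφ0 hφ hε0 hε hεlim μ hweak hf hC ha, fun a ha => ?_⟩
  have hneg : ∀ x : Σ n, S n, ∀ η : ℝ, 0 < η → ∃ r : ℝ, 0 < r ∧
      ∀ y : Σ n, S n, tdelta φ ε x y < r → |-f y - -f x| < η := by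
    simpa only [neg_sub_neg, abs_sub_comm] using hf
  have h := eventually_lt_integral_of_tdelta (f := fun x => -f x) (a := -a) hφ0 hφ hε0 hε hεlim μ
    hweak hneg (fun x => (abs_neg (f x)).trans_le (hC x))
    (by simpa only [integral_neg, neg_lt_neg_iff] using ha)
  simpa only [integral_neg, neg_lt_neg_iff] using h
end

section
/- Fix m ≥ 1 and let (x_k)_{k≥1} be a sequence with all x_k ∈ S_m. Then (x_k) is a Cauchy sequence in (T, δ) if and only if the sequence ((x_k, φ_m(x_k)))_{k≥1} is a Cauchy sequence in the product metric space (S_m × S_0, ρ_m × ρ_0). -/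
open Filter MeasureTheory Topology TopologicalSpace

theorem tdelta_mk_mk {S : ℕ → Type*} [∀ n, MetricSpace (S n)]
    (φ : ∀ n, S n → S 0) (ε : ℕ → ℝ) (m : ℕ) (a b : S m) :
    tdelta φ ε ⟨m, a⟩ ⟨m, b⟩ = dist (φ m a) (φ m b) + min (ε m) (dist a b) := by
  simp [tdelta, fiberDist]

/-- fix `m ≥ 1` and a sequence lying entirely in `S m`. It is
`δ`-Cauchy in `T` iff the sequence `k ↦ (x k, φ m (x k))` is Cauchy in the product
metric space `S m × S 0`. -/
theorem tdelta_cauchy_iff_graph_cauchy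
    (S : ℕ → Type*) [∀ n, MetricSpace (S n)]
    (φ : ∀ n, S n → S 0) (hφ0 : φ 0 = id)
    (ε : ℕ → ℝ) (hε0 : ε 0 = 0) (hεpos : ∀ n, 1 ≤ n → 0 < ε n)
    (hεanti : StrictAntiOn ε (Set.Ici 1))
    (hεlim : Tendsto ε atTop (nhds 0))
    (m : ℕ) (hm : 1 ≤ m) (x : ℕ → S m) :
    (∀ r : ℝ, 0 < r → ∃ N, ∀ k ≥ N, ∀ l ≥ N,
        tdelta φ ε (⟨m, x k⟩ : Σ n, S n) ⟨m, x l⟩ < r) ↔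
      CauchySeq (fun k => ((x k, φ m (x k)) : S m × S 0)) := by
  simp only [tdelta_mk_mk, Metric.cauchySeq_iff, Prod.dist_eq, max_lt_iff]
  have hε := hεpos m hm
  constructor
  · intro h r hr
    obtain ⟨N, hN⟩ := h (min r (ε m)) (lt_min hr hε)
    refine ⟨N, fun k hk l hl => ?_⟩
    obtain ⟨hlt_r, hlt_ε⟩ := lt_min_iff.mp (hN k hk l hl)
    have hφ : 0 ≤ dist (φ m (x k)) (φ m (x l)) := dist_nonneg
    have hx : 0 ≤ dist (x k) (x l) := dist_nonneg
    rcases min_cases (ε m) (dist (x k) (x l)) with ⟨hmin, -⟩ | ⟨hmin, -⟩ <;>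
      constructor <;> linarith
  · intro h r hr
    obtain ⟨N, hN⟩ := h (r / 2) (half_pos hr)
    refine ⟨N, fun k hk l hl => ?_⟩
    obtain ⟨hx, hφ⟩ := hN k hk l hl
    linarith [min_le_right (ε m) (dist (x k) (x l))]
end

section
/- Suppose (S_0, ρ_0) is complete. If (x_k)_{k≥1} is a Cauchy sequence in (T, δ) with s(x_k) → ∞ (in particular, if x_k ∈ S_k for every k), then (x_k) converges in (T, δ) to a point x_0 ∈ S_0; equivalently, there exists x_0 ∈ S_0 with ρ_0(φ_{s(x_k)}(x_k), x_0) → 0 and δ(x_k, x_0) → 0. -/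
open Filter MeasureTheory Topology TopologicalSpace

theorem fiberDist_nonneg {S : ℕ → Type*} [∀ n, MetricSpace (S n)] (x y : Σ n, S n) :
    0 ≤ fiberDist x y := by
  unfold fiberDist
  split_ifs
  · exact dist_nonneg
  · exact le_rfl

theorem dist_le_tdelta {S : ℕ → Type*} [∀ n, MetricSpace (S n)]
    (φ : ∀ n, S n → S 0) {ε : ℕ → ℝ} (hε : ∀ n, 0 ≤ ε n) (x y : Σ n, S n) :
    dist (φ x.1 x.2) (φ y.1 y.2) ≤ tdelta φ ε x y := by
  unfold tdelta
  refine le_add_of_nonneg_right ?_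
  split_ifs
  · exact le_min (hε _) (fiberDist_nonneg x y)
  · exact le_max_of_le_left (hε _)

/-- if `(S 0, ρ 0)` is complete and `(x k)` is a `δ`-Cauchy sequence in
`T` with `s (x k) → ∞`, then `(x k)` converges in `(T, δ)` to a point `x₀ ∈ S 0`:
`ρ₀ (φ_{s(x k)}(x k), x₀) → 0` and `δ (x k, x₀) → 0`. -/
theorem tdelta_cauchy_escaping_converges
    (S : ℕ → Type*) [∀ n, MetricSpace (S n)]
    [CompleteSpace (S 0)]
    (φ : ∀ n, S n → S 0) (hφ0 : φ 0 = id)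
    (ε : ℕ → ℝ) (hε0 : ε 0 = 0) (hεpos : ∀ n, 1 ≤ n → 0 < ε n)
    (hεanti : StrictAntiOn ε (Set.Ici 1))
    (hεlim : Tendsto ε atTop (nhds 0))
    (x : ℕ → Σ n, S n)
    (hcauchy : ∀ r : ℝ, 0 < r → ∃ N, ∀ k ≥ N, ∀ l ≥ N, tdelta φ ε (x k) (x l) < r)
    (hesc : Tendsto (fun k => (x k).1) atTop atTop) :
    ∃ x0 : S 0,
      Tendsto (fun k => dist (φ (x k).1 (x k).2) x0) atTop (nhds 0) ∧
      Tendsto (fun k => tdelta φ ε (x k) ⟨0, x0⟩) atTop (nhds 0) := by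
  have hε : ∀ n, 0 ≤ ε n := fun n => by
    rcases Nat.eq_zero_or_pos n with rfl | hn
    · exact hε0.ge
    · exact (hεpos n hn).le
  have hφx : CauchySeq fun k => φ (x k).1 (x k).2 := by
    refine Metric.cauchySeq_iff.2 fun r hr => ?_
    obtain ⟨N, hN⟩ := hcauchy r hr
    exact ⟨N, fun k hk l hl => (dist_le_tdelta φ hε _ _).trans_lt (hN k hk l hl)⟩
  obtain ⟨x0, hx0⟩ := cauchySeq_tendsto_of_complete hφx
  have hdist := tendsto_iff_dist_tendsto_zero.1 hx0
  refine ⟨x0, hdist, ?_⟩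
  have hsum := hdist.add (hεlim.comp hesc)
  rw [add_zero] at hsum
  refine hsum.congr' ?_
  filter_upwards [hesc.eventually_ge_atTop 1] with k hk
  have hne : (x k).1 ≠ 0 := Nat.one_le_iff_ne_zero.1 hk
  simp [tdelta, hne, hφ0, hε0, hε]
end
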